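/- Let u ≤_k w and x ≤_l z with wu⁻¹ = zx⁻¹. Then the map v ↦ v u⁻¹ x is an order isomorphism from the interval [u,w]_k = {v : u ≤_k v ≤_k w} in the k-Bruhat order onto the interval [x,z]_l = {v : x ≤_l v ≤_l z} in the l-Bruhat order. -/

import Mathlib

/-- A permutation of the positive integers belongs to `S_∞` when it moves only
finitely many points. -/
def FinSupp (w : Equiv.Perm ℕ+) : Prop := {x : ℕ+ | w x ≠ x}.Finite

/-- The length `ℓ(w)` of a permutation: its number of inversions, i.e. of pairs
`i < j` with `w i > w j`. -/
noncomputable def len (w : Equiv.Perm ℕ+) : ℕ :=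
  Set.ncard {p : ℕ+ × ℕ+ | p.1 < p.2 ∧ w p.2 < w p.1}

/-- Covering relation of the `k`-Bruhat order: `u ⋖_k u(a,b)` for `a ≤ k < b`
with `ℓ(u(a,b)) = ℓ(u) + 1`.  Here `u(a,b) = u * (swap a b)`. -/
def kBruhatCov (k : ℕ+) (u w : Equiv.Perm ℕ+) : Prop :=
  ∃ a b : ℕ+, a ≤ k ∧ k < b ∧ w = u * Equiv.swap a b ∧ len w = len u + 1

/-- The `k`-Bruhat order `u ≤_k w`: a chain of `k`-Bruhat covers from `u` to `w`
(or `u = w`). -/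
def kBruhat (k : ℕ+) : Equiv.Perm ℕ+ → Equiv.Perm ℕ+ → Prop :=
  Relation.ReflTransGen (kBruhatCov k)

open Equiv

/-- The numerical criterion for the `k`-Bruhat order: values weakly increase at positions `≤ k`,
weakly decrease at positions `> k`, and no inversion is created on either side of `k`. -/
structure KBruhatCriterion (k : ℕ+) (u w : Perm ℕ+) : Prop where
  le_left : ∀ i ≤ k, u i ≤ w i
  le_right : ∀ i, k < i → w i ≤ u i
  mono_left : ∀ i j, i < j → j ≤ k → u i < u j → w i < w j
  mono_right : ∀ i j, i < j → k < i → u i < u j → w i < w j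

theorem FinSupp.mul_swap {u : Perm ℕ+} (hu : FinSupp u) (a b : ℕ+) :
    FinSupp (u * swap a b) := by
  refine (hu.union (Set.toFinite {a, b})).subset fun i hi => ?_
  by_contra hc
  simp only [Set.mem_union, Set.mem_ofPred_eq, Set.mem_insert_iff, Set.mem_singleton_iff,
    not_or, not_not] at hc
  exact hi (by simp [swap_apply_of_ne_of_ne hc.2.1 hc.2.2, hc.1])

theorem FinSupp.finite_inversions {u : Perm ℕ+} (hu : FinSupp u) :
    {p : ℕ+ × ℕ+ | p.1 < p.2 ∧ u p.2 < u p.1}.Finite := by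
  obtain ⟨N, hN⟩ := hu.bddAbove
  have fix : ∀ i, N < i → u i = i := fun i hi => by
    by_contra hc
    exact absurd (hN hc) (not_le.mpr hi)
  have bound : ∀ i, i ≤ N → u i ≤ N := fun i hi => by
    by_contra hc
    exact hc ((u.injective (fix _ (not_le.mp hc))).le.trans hi)
  refine ((Set.finite_Iic N).prod (Set.finite_Iic N)).subset ?_
  rintro ⟨i, j⟩ ⟨hij, hu⟩
  simp only [Set.mem_prod, Set.mem_Iic] at hij hu ⊢
  have hi : i ≤ N := by
    by_contra hc
    rw [fix i (not_le.mp hc), fix j ((not_le.mp hc).trans hij)] at hu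
    exact absurd hu (not_lt.mpr hij.le)
  refine ⟨hi, ?_⟩
  by_contra hc
  rw [fix j (not_le.mp hc)] at hu
  exact hc (hu.le.trans (bound i hi))

/-- The involution on pairs `i < j` that applies `swap a b` to both entries whenever this keeps
them in increasing order. -/
def swapPair (a b : ℕ+) (p : ℕ+ × ℕ+) : ℕ+ × ℕ+ :=
  if swap a b p.1 < swap a b p.2 then (swap a b p.1, swap a b p.2) else p

theorem swapPair_swapPair (a b : ℕ+) {p : ℕ+ × ℕ+} (hp : p.1 < p.2) :
    swapPair a b (swapPair a b p) = p := by
  unfold swapPair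
  split_ifs with h <;> simp_all

theorem swapPair_injOn (a b : ℕ+) : Set.InjOn (swapPair a b) {p | p.1 < p.2} := by
  intro p hp q hq h
  rw [← swapPair_swapPair a b hp, h, swapPair_swapPair a b hq]

theorem swapPair_injOn_inversions (a b : ℕ+) (u : Perm ℕ+) :
    Set.InjOn (swapPair a b) {p | p.1 < p.2 ∧ u p.2 < u p.1} :=
  (swapPair_injOn a b).mono fun _ hp => hp.1

theorem swapPair_eq_iff {a b : ℕ+} (hab : a < b) {p : ℕ+ × ℕ+} (hp : p.1 < p.2) :
    swapPair a b p = (a, b) ↔ p = (a, b) := by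
  have hfix : swapPair a b (a, b) = (a, b) := by simp [swapPair, hab.le]
  constructor
  · intro h
    rw [← swapPair_swapPair a b hp, h, hfix]
  · rintro rfl
    exact hfix

theorem swapPair_mem_inversions {u : Perm ℕ+} {a b : ℕ+} (hab : a < b) (huab : u a < u b)
    {p : ℕ+ × ℕ+} (hp : p.1 < p.2 ∧ u p.2 < u p.1) :
    (swapPair a b p).1 < (swapPair a b p).2 ∧
      (u * swap a b) (swapPair a b p).2 < (u * swap a b) (swapPair a b p).1 := by
  obtain ⟨i, j⟩ := p
  unfold swapPair
  split_ifs with h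
  · simpa using ⟨h, hp.2⟩
  · refine ⟨hp.1, ?_⟩
    simp only [Perm.mul_apply, swap_apply_def] at *
    grind

theorem mem_image_swapPair {u : Perm ℕ+} {a b : ℕ+} (hab : a < b) (huab : u a < u b)
    (hbetween : ∀ c, a < c → c < b → ¬(u a < u c ∧ u c < u b))
    {p : ℕ+ × ℕ+} (hp : p.1 < p.2 ∧ (u * swap a b) p.2 < (u * swap a b) p.1)
    (hne : p ≠ (a, b)) :
    (swapPair a b p).1 < (swapPair a b p).2 ∧
      u (swapPair a b p).2 < u (swapPair a b p).1 := by
  obtain ⟨i, j⟩ := p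
  unfold swapPair
  split_ifs with h
  · exact ⟨h, hp.2⟩
  · refine ⟨hp.1, ?_⟩
    have hinj := u.injective.eq_iff (a := i) (b := a)
    have hinj' := u.injective.eq_iff (a := j) (b := a)
    have hinj₂ := u.injective.eq_iff (a := i) (b := b)
    have hinj₂' := u.injective.eq_iff (a := j) (b := b)
    have h₁ := hbetween i
    have h₂ := hbetween j
    clear hbetween
    simp only [Perm.mul_apply, swap_apply_def] at hp h
    have h₃ := lt_trichotomy i a
    have h₄ := lt_trichotomy j b
    have h₅ := lt_trichotomy (u i) (u b)
    have h₆ := lt_trichotomy (u j) (u a)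
    split_ifs at hp h <;> grind

theorem len_mul_swap_eq {u : Perm ℕ+} (hu : FinSupp u) {a b : ℕ+} (hab : a < b)
    (huab : u a < u b) (hbetween : ∀ c, a < c → c < b → ¬(u a < u c ∧ u c < u b)) :
    len (u * swap a b) = len u + 1 := by
  have hset : {p : ℕ+ × ℕ+ | p.1 < p.2 ∧ (u * swap a b) p.2 < (u * swap a b) p.1} =
      insert (a, b) (swapPair a b '' {p | p.1 < p.2 ∧ u p.2 < u p.1}) := by
    ext p
    constructor
    · intro hp
      by_cases hne : p = (a, b)
      · exact Or.inl hne
      · exact Or.inr ⟨_, mem_image_swapPair hab huab hbetween hp hne,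
          swapPair_swapPair a b hp.1⟩
    · rintro (rfl | ⟨q, hq, rfl⟩)
      · simpa using ⟨hab, huab⟩
      · exact swapPair_mem_inversions hab huab hq
  unfold len
  rw [hset, Set.ncard_insert_of_notMem _ (hu.finite_inversions.image _),
    (swapPair_injOn_inversions a b u).ncard_image]
  rintro ⟨q, hq, h⟩
  rw [swapPair_eq_iff hab hq.1] at h
  subst h
  exact absurd hq.2 huab.le.not_gt

theorem len_lt_len_mul_swap {u : Perm ℕ+} (hu : FinSupp u) {a b : ℕ+} (hab : a < b)
    (huab : u a < u b) : len u < len (u * swap a b) := by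
  unfold len
  rw [← (swapPair_injOn_inversions a b u).ncard_image]
  refine Set.ncard_lt_ncard ?_ (hu.mul_swap a b).finite_inversions
  rw [Set.ssubset_iff_of_subset]
  · refine ⟨(a, b), by simpa using ⟨hab, huab⟩, ?_⟩
    rintro ⟨q, hq, h⟩
    rw [swapPair_eq_iff hab hq.1] at h
    subst h
    exact absurd hq.2 huab.le.not_gt
  · rintro _ ⟨q, hq, rfl⟩
    exact swapPair_mem_inversions hab huab hq

theorem len_add_one_lt_len_mul_swap {u : Perm ℕ+} (hu : FinSupp u) {a b c : ℕ+} (hac : a < c)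
    (hcb : c < b) (huac : u a < u c) (hucb : u c < u b) :
    len u + 1 < len (u * swap a b) := by
  have hab := hac.trans hcb
  have huab := huac.trans hucb
  unfold len
  rw [← (swapPair_injOn_inversions a b u).ncard_image,
    ← Set.ncard_insert_of_notMem (a := (a, b)) _ (hu.finite_inversions.image _)]
  · refine Set.ncard_lt_ncard ?_ (hu.mul_swap a b).finite_inversions
    rw [Set.ssubset_iff_of_subset]
    · refine ⟨(a, c), ?_, ?_⟩
      · simpa [swap_apply_of_ne_of_ne hac.ne' hcb.ne] using ⟨hac, hucb⟩
      · rintro (h | ⟨q, hq, h⟩)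
        · exact hcb.ne (Prod.ext_iff.mp h).2
        · have hq' := swapPair_swapPair a b hq.1
          have hfix : swapPair a b (a, c) = (a, c) := by
            simp [swapPair, swap_apply_of_ne_of_ne hac.ne' hcb.ne, hcb.le.not_gt]
          rw [h, hfix] at hq'
          subst hq'
          exact absurd hq.2 huac.le.not_gt
    · rintro _ (rfl | ⟨q, hq, rfl⟩)
      · simpa using ⟨hab, huab⟩
      · exact swapPair_mem_inversions hab huab hq
  · rintro ⟨q, hq, h⟩
    rw [swapPair_eq_iff hab hq.1] at h
    subst h
    exact absurd hq.2 huab.le.not_gt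

theorem len_mul_swap_eq_iff {u : Perm ℕ+} (hu : FinSupp u) {a b : ℕ+} (hab : a < b) :
    len (u * swap a b) = len u + 1 ↔
      u a < u b ∧ ∀ c, a < c → c < b → ¬(u a < u c ∧ u c < u b) := by
  refine ⟨fun h => ?_, fun h => len_mul_swap_eq hu hab h.1 h.2⟩
  have huab : u a < u b := by
    by_contra hc
    have hlt : u b < u a := lt_of_le_of_ne (not_lt.mp hc) (u.injective.ne hab.ne')
    have := len_lt_len_mul_swap (hu.mul_swap a b) hab (by simpa using hlt)
    rw [mul_assoc, swap_mul_self, mul_one] at this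
    omega
  refine ⟨huab, fun c hac hcb hc => ?_⟩
  have := len_add_one_lt_len_mul_swap hu hac hcb hc.1 hc.2
  omega

/-- If the values of a permutation of `ℕ+` never exceed those of another, the two agree. -/
theorem perm_eq_of_forall_le {u w : Perm ℕ+} (h : ∀ i, w i ≤ u i) : u = w := by
  have key : ∀ n i, u i = n → w i = n := by
    intro n
    induction n using WellFoundedLT.induction with
    | ind n ih =>
      intro i hi
      by_contra hne
      have hlt : w i < n := lt_of_le_of_ne (hi ▸ h i) hne
      have h₁ := ih (w i) hlt (u.symm (w i)) (by simp)
      have h₂ := u.symm_apply_eq.mp (w.injective h₁)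
      exact hne (h₂.trans hi)
  ext i
  rw [key _ i rfl]

namespace KBruhatCriterion

theorem refl (k : ℕ+) (u : Perm ℕ+) : KBruhatCriterion k u u :=
  ⟨fun _ _ => le_rfl, fun _ _ => le_rfl, fun _ _ _ _ h => h, fun _ _ _ _ h => h⟩

theorem trans {k : ℕ+} {u v w : Perm ℕ+} (huv : KBruhatCriterion k u v)
    (hvw : KBruhatCriterion k v w) : KBruhatCriterion k u w :=
  ⟨fun i hi => (huv.le_left i hi).trans (hvw.le_left i hi),
    fun i hi => (hvw.le_right i hi).trans (huv.le_right i hi),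
    fun i j hij hj h => hvw.mono_left i j hij hj (huv.mono_left i j hij hj h),
    fun i j hij hi h => hvw.mono_right i j hij hi (huv.mono_right i j hij hi h)⟩

theorem mul_swap {k : ℕ+} {u : Perm ℕ+} {a b : ℕ+} (ha : a ≤ k) (hb : k < b)
    (huab : u a < u b) (hbetween : ∀ c, a < c → c < b → ¬(u a < u c ∧ u c < u b)) :
    KBruhatCriterion k u (u * swap a b) := by
  have hinj := u.injective
  constructor
  · intro i hi
    simp only [Perm.mul_apply, swap_apply_def]
    grind
  · intro i hi
    simp only [Perm.mul_apply, swap_apply_def]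
    grind
  · intro i j hij hj h
    have := hbetween j
    have := hinj.eq_iff (a := j) (b := b)
    simp only [Perm.mul_apply, swap_apply_def]
    grind
  · intro i j hij hi h
    have := hbetween i
    have := hinj.eq_iff (a := i) (b := a)
    simp only [Perm.mul_apply, swap_apply_def]
    grind

/-- Above the largest value that moves up there is a value moving down past it. -/
theorem exists_crossing {k : ℕ+} {u w : Perm ℕ+} (h : KBruhatCriterion k u w) {a : ℕ+}
    (haw : u a < w a) (hmax : ∀ i ≤ k, u i < w i → u i ≤ u a) :
    ∃ b, k < b ∧ w b ≤ u a ∧ u a < u b ∧ u b ≤ w a := by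
  by_contra! hc
  set ζ : Perm ℕ+ := w * u⁻¹ with hζ
  have hmaps : ∀ γ ∈ Finset.Ioc (u a) (w a), ζ γ ∈ Finset.Ioc (u a) (w a) := by
    intro γ hγ
    rw [Finset.mem_Ioc] at hγ ⊢
    obtain ⟨i, rfl⟩ := u.surjective γ
    simp only [hζ, Perm.mul_apply, Perm.coe_inv, symm_apply_apply]
    rcases le_or_gt i k with hi | hi
    · have h₁ := h.le_left i hi
      have h₂ := hmax i hi
      rcases h₁.eq_or_lt with h₁ | h₁
      · rw [← h₁]
        exact hγ
      · exact absurd (h₂ h₁) (not_le.mpr hγ.1)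
    · refine ⟨?_, (h.le_right i hi).trans hγ.2⟩
      by_contra hcon
      exact absurd (hc i hi (not_lt.mp hcon) hγ.1) (not_lt.mpr hγ.2)
  have himage : (Finset.Ioc (u a) (w a)).image ζ = Finset.Ioc (u a) (w a) := by
    refine Finset.eq_of_subset_of_card_le (Finset.image_subset_iff.mpr hmaps) ?_
    rw [Finset.card_image_of_injective _ ζ.injective]
  have hmem : w a ∈ (Finset.Ioc (u a) (w a)).image ζ := by
    rw [himage, Finset.mem_Ioc]
    exact ⟨haw, le_rfl⟩
  obtain ⟨γ, hγ, hγa⟩ := Finset.mem_image.mp hmem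
  have : ζ γ = ζ (u a) := by simpa [hζ] using hγa
  rw [ζ.injective this, Finset.mem_Ioc] at hγ
  exact lt_irrefl _ hγ.1

theorem exists_mul_swap {k : ℕ+} {u w : Perm ℕ+} (h : KBruhatCriterion k u w) (hne : u ≠ w) :
    ∃ a b, a ≤ k ∧ k < b ∧ u a < u b ∧ u b ≤ w a ∧
      (∀ c, a < c → c < b → ¬(u a < u c ∧ u c < u b)) ∧
      KBruhatCriterion k (u * swap a b) w := by
  have hup : ∃ a ≤ k, u a < w a := by
    by_contra! hc
    exact hne (perm_eq_of_forall_le fun i => (le_or_gt i k).elim (hc i) (h.le_right i))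
  obtain ⟨a₀, ha₀, ha₀w⟩ := hup
  obtain ⟨a, ha, hmax⟩ := Finset.exists_max_image ((Finset.Iic k).filter fun i => u i < w i) u
    ⟨a₀, by simp [ha₀, ha₀w]⟩
  simp only [Finset.mem_filter, Finset.mem_Iic, and_imp] at ha hmax
  obtain ⟨hak, haw⟩ := ha
  have hcross := h.exists_crossing haw hmax
  obtain ⟨β, ⟨b, hβ, hbk, hwb, hab, hbw⟩, hmin⟩ := WellFounded.has_min
    (wellFounded_lt (α := ℕ+))
    {β | ∃ b, u b = β ∧ k < b ∧ w b ≤ u a ∧ u a < u b ∧ u b ≤ w a}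
    (hcross.imp' u fun b hb => ⟨b, rfl, hb⟩)
  subst hβ
  replace hmin : ∀ c, k < c → w c ≤ u a → u a < u c → u b ≤ u c := fun c hck hwc hac => by
    by_contra hlt
    exact hmin (u c) ⟨c, rfl, hck, hwc, hac, (not_le.mp hlt).le.trans hbw⟩ (not_le.mp hlt)
  refine ⟨a, b, hak, hbk, hab, hbw, ?_, ?_⟩
  · rintro c hac hcb ⟨h₁, h₂⟩
    rcases le_or_gt c k with hck | hck
    · exact (hmax c hck ((h₂.trans_le hbw).trans (h.mono_left a c hac hck h₁))).not_gt h₁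
    · exact (hmin c hck ((h.mono_right c b hcb hck h₂).le.trans hwb) h₁).not_gt h₂
  · constructor
    · intro i hi
      have := h.le_left i hi
      simp only [Perm.mul_apply, swap_apply_def]
      grind
    · intro i hi
      have := h.le_right i hi
      simp only [Perm.mul_apply, swap_apply_def]
      grind
    · intro i j hij hj hlt
      have := h.mono_left i j hij hj
      have := hmax i (hij.le.trans hj)
      have := h.le_left i (hij.le.trans hj)
      have := u.injective.eq_iff (a := i) (b := a)
      simp only [Perm.mul_apply, swap_apply_def] at hlt
      grind
    · intro i j hij hi hlt
      have := h.mono_right i j hij hi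
      have := hmin j (hi.trans hij)
      have := h.le_right j (hi.trans hij)
      have := u.injective.eq_iff (a := j) (b := b)
      simp only [Perm.mul_apply, swap_apply_def] at hlt
      grind

theorem kBruhat {k : ℕ+} {u w : Perm ℕ+} (hu : FinSupp u) (h : KBruhatCriterion k u w) :
    kBruhat k u w := by
  induction hn : ∑ i ∈ Finset.Iic k, ((w i : ℕ) - u i) using Nat.strong_induction_on
    generalizing u with
  | _ n ih =>
    by_cases hne : u = w
    · exact hne ▸ Relation.ReflTransGen.refl
    obtain ⟨a, b, ha, hb, hab, hbw, hbetween, h'⟩ := h.exists_mul_swap hne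
    refine Relation.ReflTransGen.head
      ⟨a, b, ha, hb, rfl, len_mul_swap_eq hu (ha.trans_lt hb) hab hbetween⟩
      (ih _ ?_ (hu.mul_swap a b) h' rfl)
    rw [← hn]
    have hle := (mul_swap ha hb hab hbetween).le_left
    refine Finset.sum_lt_sum (fun i hi => ?_) ⟨a, by simpa using ha, ?_⟩
    · have := PNat.coe_le_coe _ _ |>.mpr (hle i (by simpa using hi))
      omega
    · have h₁ := PNat.coe_lt_coe _ _ |>.mpr hab
      have h₂ := PNat.coe_le_coe _ _ |>.mpr hbw
      simp only [Perm.mul_apply, swap_apply_left]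
      omega

end KBruhatCriterion

theorem kBruhatCov_iff {k : ℕ+} {u w : Perm ℕ+} (hu : FinSupp u) :
    kBruhatCov k u w ↔ ∃ a b, a ≤ k ∧ k < b ∧ w = u * swap a b ∧ u a < u b ∧
      ∀ c, a < c → c < b → ¬(u a < u c ∧ u c < u b) := by
  refine exists₂_congr fun a b => ?_
  refine and_congr_right fun ha => and_congr_right fun hb => and_congr_right fun hw => ?_
  rw [hw, len_mul_swap_eq_iff hu (ha.trans_lt hb)]

theorem kBruhatCov.finSupp {k : ℕ+} {u w : Perm ℕ+} (h : kBruhatCov k u w) (hu : FinSupp u) :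
    FinSupp w := by
  obtain ⟨a, b, -, -, rfl, -⟩ := h
  exact hu.mul_swap a b

theorem kBruhat.finSupp {k : ℕ+} {u w : Perm ℕ+} (h : kBruhat k u w) (hu : FinSupp u) :
    FinSupp w := by
  induction h with
  | refl => exact hu
  | tail _ hc ih => exact hc.finSupp ih

theorem kBruhat.criterion {k : ℕ+} {u w : Perm ℕ+} (h : kBruhat k u w) (hu : FinSupp u) :
    KBruhatCriterion k u w := by
  induction h with
  | refl => exact .refl k u
  | tail hc hcov ih =>
    obtain ⟨a, b, ha, hb, rfl, hab, hbetween⟩ := (kBruhatCov_iff (kBruhat.finSupp hc hu)).mp hcov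
    exact ih.trans (.mul_swap ha hb hab hbetween)

/-- A first step of a `k`-Bruhat chain from `u` to `w` transfers to a first step of an `l`-Bruhat
chain from `x` to `z` when `w * u⁻¹ = z * x⁻¹`. -/
theorem kBruhatCov.transfer {k l : ℕ+} {u u' w x z : Perm ℕ+} (hu : FinSupp u) (hx : FinSupp x)
    (hcov : kBruhatCov k u u') (hw : KBruhatCriterion k u' w) (hz : KBruhatCriterion l x z)
    (h : w * u⁻¹ = z * x⁻¹) :
    kBruhatCov l x (u' * u⁻¹ * x) ∧ KBruhatCriterion l (u' * u⁻¹ * x) z := by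
  obtain ⟨a, b, ha, hb, rfl, hab, hbetween⟩ := (kBruhatCov_iff hu).mp hcov
  have huw := (KBruhatCriterion.mul_swap ha hb hab hbetween).trans hw
  have hzw : ∀ i j, x i = u j → z i = w j := fun i j hij => by
    have := congrArg (fun σ : Perm ℕ+ => σ (u j)) h
    simp only [Perm.mul_apply, Perm.coe_inv, symm_apply_apply] at this
    rw [this, ← hij, symm_apply_apply]
  obtain ⟨a', ha'⟩ := x.surjective (u a)
  obtain ⟨b', hb'⟩ := x.surjective (u b)
  have hza := hzw a' a ha'
  have hzb := hzw b' b hb'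
  have hwa : u b ≤ w a := by simpa using hw.le_left a ha
  have hwb : w b ≤ u a := by simpa using hw.le_right b hb
  have hal : a' ≤ l := by
    by_contra hc
    have := hz.le_right a' (not_le.mp hc)
    rw [ha', hza] at this
    exact absurd (hab.trans_le (hwa.trans this)) (lt_irrefl _)
  have hbl : l < b' := by
    by_contra hc
    have := hz.le_left b' (not_lt.mp hc)
    rw [hb', hzb] at this
    exact absurd (hab.trans_le (this.trans hwb)) (lt_irrefl _)
  have hx' : u * swap a b * u⁻¹ * x = x * swap a' b' := by
    rw [mul_swap_eq_swap_mul, mul_swap_eq_swap_mul, ha', hb']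
    group
  have hxab : x a' < x b' := by rwa [ha', hb']
  have low : ∀ i ≤ l, x a' < x i → x i < x b' → z i < z a' := by
    intro i hi h₁ h₂
    obtain ⟨c, hc⟩ := u.surjective (x i)
    have hzc := hzw i c hc.symm
    have hle := hz.le_left i hi
    rw [ha', ← hc] at h₁
    rw [hb', ← hc] at h₂
    rw [hzc, ← hc] at hle
    rw [hza, hzc]
    rcases le_or_gt c k with hck | hck
    · have hne : c ≠ a := fun e => by simp [e] at h₁
      have hca : c < a := by
        by_contra hlt
        exact hbetween c (lt_of_le_of_ne (not_lt.mp hlt) hne.symm) (hck.trans_lt hb) ⟨h₁, h₂⟩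
      refine hw.mono_left c a hca ha ?_
      simpa [swap_apply_of_ne_of_ne hne (hck.trans_lt hb).ne] using h₂
    · exact ((huw.le_right c hck).trans_lt h₂).trans_le hwa
  have high : ∀ i, l < i → x a' < x i → x i < x b' → z b' < z i := by
    intro i hi h₁ h₂
    obtain ⟨c, hc⟩ := u.surjective (x i)
    have hzc := hzw i c hc.symm
    rw [ha', ← hc] at h₁
    rw [hb', ← hc] at h₂
    rw [hzb, hzc]
    rcases le_or_gt c k with hck | hck
    · exact hwb.trans_lt (h₁.trans_le (huw.le_left c hck))
    · have hne : c ≠ b := fun e => by simp [e] at h₂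
      have hbc : b < c := by
        by_contra hlt
        exact hbetween c (ha.trans_lt hck) (lt_of_le_of_ne (not_lt.mp hlt) hne) ⟨h₁, h₂⟩
      refine hw.mono_right b c hbc hb ?_
      simpa [swap_apply_of_ne_of_ne (ha.trans_lt hck).ne' hne] using h₁
  rw [hx', kBruhatCov_iff hx]
  refine ⟨⟨a', b', hal, hbl, rfl, hxab, ?_⟩, ?_⟩
  · rintro c hac hcb ⟨h₁, h₂⟩
    rcases le_or_gt c l with hcl | hcl
    · exact lt_asymm (low c hcl h₁ h₂) (hz.mono_left a' c hac hcl h₁)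
    · exact lt_asymm (high c hcl h₁ h₂) (hz.mono_right c b' hcb hcl h₂)
  · rw [← hza, ← hb'] at hwa
    rw [← hzb, ← ha'] at hwb
    clear hx' hzw huw hw h hbetween
    constructor
    · intro i hi
      have := hz.le_left i hi
      simp only [Perm.mul_apply, swap_apply_def]
      grind
    · intro i hi
      have := hz.le_right i hi
      simp only [Perm.mul_apply, swap_apply_def]
      grind
    · intro i j hij hj hlt
      have := hz.mono_left i j hij hj
      have := low i (hij.le.trans hj)
      have := x.injective.eq_iff (a := i) (b := a')
      simp only [Perm.mul_apply, swap_apply_def] at hlt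
      grind
    · intro i j hij hi hlt
      have := hz.mono_right i j hij hi
      have := high j (hi.trans hij)
      have := x.injective.eq_iff (a := j) (b := b')
      simp only [Perm.mul_apply, swap_apply_def] at hlt
      grind

theorem mul_inv_eq_mul_inv_of_eq {G : Type*} [Group G] {u w x z : G}
    (h : w * u⁻¹ = z * x⁻¹) (v : G) : w * v⁻¹ = z * (v * u⁻¹ * x)⁻¹ := by
  rw [← inv_mul_cancel_right w u, h]
  group

theorem kBruhat.transfer {k l : ℕ+} {u v w x z : Perm ℕ+} (hu : FinSupp u) (hx : FinSupp x)
    (huv : kBruhat k u v) (hvw : kBruhat k v w) (hxz : kBruhat l x z)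
    (h : w * u⁻¹ = z * x⁻¹) :
    kBruhat l x (v * u⁻¹ * x) ∧ kBruhat l (v * u⁻¹ * x) z := by
  replace hxz := hxz.criterion hx
  induction huv using Relation.ReflTransGen.head_induction_on generalizing x with
  | refl => simpa using ⟨Relation.ReflTransGen.refl, hxz.kBruhat hx⟩
  | @head u u' hcov hc ih =>
    have hu' := hcov.finSupp hu
    obtain ⟨hcov', hz⟩ := hcov.transfer hu hx
      (kBruhat.criterion (Relation.ReflTransGen.trans hc hvw) hu') hxz h
    have := ih hu' (hcov'.finSupp hx) (mul_inv_eq_mul_inv_of_eq h u') hz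
    rw [show v * u'⁻¹ * (u' * u⁻¹ * x) = v * u⁻¹ * x by group] at this
    exact ⟨Relation.ReflTransGen.head hcov' this.1, this.2⟩

/-- If `u ≤_k w`, `x ≤_l z` and `w u⁻¹ = z x⁻¹`, then `v ↦ v u⁻¹ x` is an order
isomorphism from the interval `[u,w]_k` onto the interval `[x,z]_l`:
it maps `[u,w]_k` into `[x,z]_l`, it is onto `[x,z]_l`, and it preserves and
reflects the respective Bruhat orders. -/
theorem stmt_5 (k l : ℕ+) (u w x z : Equiv.Perm ℕ+)
    (hu : FinSupp u) (hw : FinSupp w) (hx : FinSupp x) (hz : FinSupp z)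
    (huw : kBruhat k u w) (hxz : kBruhat l x z)
    (h : w * u⁻¹ = z * x⁻¹) :
    (∀ v : Equiv.Perm ℕ+, kBruhat k u v → kBruhat k v w →
        kBruhat l x (v * u⁻¹ * x) ∧ kBruhat l (v * u⁻¹ * x) z) ∧
    (∀ v' : Equiv.Perm ℕ+, kBruhat l x v' → kBruhat l v' z →
        ∃ v : Equiv.Perm ℕ+, kBruhat k u v ∧ kBruhat k v w ∧ v * u⁻¹ * x = v') ∧
    (∀ v₁ v₂ : Equiv.Perm ℕ+, kBruhat k u v₁ → kBruhat k v₁ w →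
        kBruhat k u v₂ → kBruhat k v₂ w →
        (kBruhat k v₁ v₂ ↔ kBruhat l (v₁ * u⁻¹ * x) (v₂ * u⁻¹ * x))) := by
  refine ⟨fun v huv hvw => huv.transfer hu hx hvw hxz h, fun v' hxv hvz => ?_,
    fun v₁ v₂ huv₁ hv₁w huv₂ hv₂w => ?_⟩
  · have := hxv.transfer hx hu hvz huw h.symm
    exact ⟨v' * x⁻¹ * u, this.1, this.2, by group⟩
  · obtain ⟨hx₁, h₁z⟩ := huv₁.transfer hu hx hv₁w hxz h
    obtain ⟨-, h₂z⟩ := huv₂.transfer hu hx hv₂w hxz h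
    have hv₁ := huv₁.finSupp hu
    have hxv₁ := hx₁.finSupp hx
    have h' := mul_inv_eq_mul_inv_of_eq h v₁
    constructor
    · intro h₁₂
      have := (h₁₂.transfer hv₁ hxv₁ hv₂w h₁z h').1
      rwa [show v₂ * v₁⁻¹ * (v₁ * u⁻¹ * x) = v₂ * u⁻¹ * x by group] at this
    · intro h₁₂
      have := (h₁₂.transfer hxv₁ hv₁ h₂z hv₁w h'.symm).1
      rwa [show v₂ * u⁻¹ * x * (v₁ * u⁻¹ * x)⁻¹ * v₁ = v₂ by group] at this
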